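/- Let n = 2m be a squarefree even positive integer (so m is odd), let d = 4d₁ + 2 with d₁ ≥ 0 an integer, and let b ∈ ℤ^d have every coordinate odd, so that −b·b = 2c for some odd integer c. Then g_n(b) = (−1)^{d₁} · (2n)^{2d₁+1} · r((c+m)/2, n), where (c+m)/2 is an integer since c and m are both odd. -/

import Mathlib

open Finset

/-- `en n x = exp(2πi x / n)` -/
noncomputable def en (n : ℕ) (x : ℤ) : ℂ := Complex.exp (2 * Real.pi * Complex.I * x / n)

/-- `g_n(b) = Σ_{0 ≤ k < n, gcd(k,n)=1} Σ_{x ∈ {0,…,n-1}^d} e_n(b·x + k(x·x))`. -/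
noncomputable def gsum (n d : ℕ) (b : Fin d → ℤ) : ℂ :=
  ∑ k ∈ (Finset.range n).filter (fun k => Nat.gcd k n = 1),
    ∑ x ∈ Fintype.piFinset fun _ : Fin d => Finset.Ico (0:ℤ) n,
      en n (∑ i, b i * x i + k * ∑ i, x i ^ 2)

/-- The Ramanujan sum `r(c, n) = Σ_{0 ≤ k < n, gcd(k,n)=1} e_n(kc)`. -/
noncomputable def ram (c : ℤ) (n : ℕ) : ℂ :=
  ∑ k ∈ (Finset.range n).filter (fun k => Nat.gcd k n = 1), en n (k * c)

lemma AddChar.map_sum_eq_prod {ι A M : Type*} [AddCommMonoid A] [CommMonoid M]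
    (ψ : AddChar A M) (s : Finset ι) (f : ι → A) : ψ (∑ i ∈ s, f i) = ∏ i ∈ s, ψ (f i) := by
  classical
  induction s using Finset.induction_on with
  | empty => simp
  | insert i s hi ih => rw [sum_insert hi, prod_insert hi, AddChar.map_add_eq_mul, ih]

/-- The factorisation of an additive character on a product. -/
lemma AddChar.prod_apply_eq {R S : Type*} [AddCommGroup R] [AddCommGroup S]
    (ψ : AddChar (R × S) ℂ) (z : R × S) :
    ψ z = ψ.compAddMonoidHom (AddMonoidHom.inl R S) z.1 *
      ψ.compAddMonoidHom (AddMonoidHom.inr R S) z.2 := by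
  simp [← AddChar.map_add_eq_mul]

lemma AddChar.IsPrimitive.comp_inl {R S : Type*} [CommRing R] [CommRing S]
    {ψ : AddChar (R × S) ℂ} (hψ : ψ.IsPrimitive) :
    (ψ.compAddMonoidHom (AddMonoidHom.inl R S)).IsPrimitive := by
  intro a ha h
  refine hψ (a := (a, 0)) (by simpa using ha) ?_
  ext z
  simpa [AddChar.mulShift_apply, Prod.mul_def] using DFunLike.congr_fun h z.1

lemma AddChar.IsPrimitive.comp_inr {R S : Type*} [CommRing R] [CommRing S]
    {ψ : AddChar (R × S) ℂ} (hψ : ψ.IsPrimitive) :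
    (ψ.compAddMonoidHom (AddMonoidHom.inr R S)).IsPrimitive := by
  intro a ha h
  refine hψ (a := (0, a)) (by simpa using ha) ?_
  ext z
  simpa [AddChar.mulShift_apply, Prod.mul_def] using DFunLike.congr_fun h z.2

lemma AddChar.IsPrimitive.comp_ringEquiv {R S : Type*} [CommRing R] [CommRing S]
    {ψ : AddChar S ℂ} (hψ : ψ.IsPrimitive) (e : R ≃+* S) :
    (ψ.compAddMonoidHom (e : R →+ S)).IsPrimitive := by
  intro a ha h
  refine hψ (a := e a) (by simpa using ha) ?_
  ext z
  simpa [AddChar.mulShift_apply] using DFunLike.congr_fun h (e.symm z)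

lemma AddChar.IsPrimitive.mulShift_unit {R : Type*} [CommRing R]
    {ψ : AddChar R ℂ} (hψ : ψ.IsPrimitive) (u : Rˣ) : (ψ.mulShift (u : R)).IsPrimitive := by
  intro a ha h
  rw [AddChar.mulShift_mulShift] at h
  exact hψ (by simpa using ha) h

lemma sum_addChar_sq_eq_gaussSum {F : Type*} [Field F] [Fintype F] [DecidableEq F]
    (hF : ringChar F ≠ 2) {ψ : AddChar F ℂ} (hψ : ψ.IsPrimitive) :
    ∑ x, ψ (x ^ 2) = gaussSum ((quadraticChar F).ringHomComp (Int.castRingHom ℂ)) ψ := by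
  have hcard (a : F) : (#{x : F | x ^ 2 = a} : ℂ) = (quadraticChar F a : ℂ) + 1 := by
    have := quadraticChar_card_sqrts hF a
    rw [Set.toFinset_ofPred] at this
    exact_mod_cast this
  have h0 : ∑ a, ψ a = 0 := by
    simpa using AddChar.sum_mulShift (1 : F) hψ
  calc ∑ x, ψ (x ^ 2) = ∑ a, ∑ x with x ^ 2 = a, ψ (x ^ 2) := (sum_fiberwise _ _ _).symm
    _ = ∑ a, ((quadraticChar F a : ℂ) + 1) * ψ a := by
      refine sum_congr rfl fun a _ ↦ ?_
      rw [← hcard, ← nsmul_eq_mul, ← sum_const]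
      exact sum_congr rfl fun x hx ↦ by rw [(mem_filter.mp hx).2]
    _ = _ := by simp [add_mul, sum_add_distrib, h0, gaussSum]

/-- The square of a quadratic Gauss sum modulo an odd squarefree integer. -/
lemma sum_addChar_sq_sq (m : ℕ) : ∀ [NeZero m] (_ : Odd m) (_ : Squarefree m)
    {ψ : AddChar (ZMod m) ℂ} (_ : ψ.IsPrimitive),
    (∑ x, ψ (x ^ 2)) ^ 2 = (ZMod.χ₄ m : ℂ) * m := by
  induction m using Nat.recOnPosPrimePosCoprime with
  | zero =>
    intro _ hodd
    simp at hodd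
  | one =>
    intro _ _ _ ψ _
    have h1 (z : ZMod 1) : ψ z = 1 := by rw [Subsingleton.elim z 0, AddChar.map_zero_eq_one]
    simp [h1]
  | prime_pow p k hp hk =>
    rcases ne_or_eq k 1 with hk1 | rfl
    · intro _ _ hsf
      exact absurd ((Nat.squarefree_pow_iff hp.ne_one hk.ne').mp hsf).2 hk1
    rw [pow_one]
    intro _ hodd hsf ψ hψ
    have : Fact p.Prime := ⟨hp⟩
    have hF : ringChar (ZMod p) ≠ 2 := by
      rw [ZMod.ringChar_zmod_n]
      rintro rfl
      exact absurd hodd (by decide)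
    rw [sum_addChar_sq_eq_gaussSum hF hψ, gaussSum_sq
      ((MulChar.ringHomComp_ne_one_iff (RingHom.injective_int _)).mpr (quadraticChar_ne_one hF))
      ((quadraticChar_isQuadratic _).comp _) hψ]
    simp [quadraticChar_neg_one hF, ZMod.card]
  | coprime a b ha hb hab iha ihb =>
    intro _ hodd hsf ψ hψ
    have : NeZero a := ⟨by lia⟩
    have : NeZero b := ⟨by lia⟩
    obtain ⟨hao, hbo⟩ := Nat.odd_mul.mp hodd
    obtain ⟨-, has, hbs⟩ := Nat.squarefree_mul_iff.mp hsf
    let e := ZMod.chineseRemainder hab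
    let φ := ψ.compAddMonoidHom (e.symm : ZMod a × ZMod b →+ ZMod (a * b))
    have hφ : φ.IsPrimitive := hψ.comp_ringEquiv e.symm
    have key : ∑ x, ψ (x ^ 2) = (∑ x, φ.compAddMonoidHom (AddMonoidHom.inl _ _) (x ^ 2)) *
        ∑ y, φ.compAddMonoidHom (AddMonoidHom.inr _ _) (y ^ 2) := by
      rw [sum_mul_sum, ← Fintype.sum_prod_type', ← e.symm.toEquiv.sum_comp]
      refine sum_congr rfl fun z _ ↦ ?_
      have : ψ (e.symm z ^ 2) = φ (z ^ 2) := by simp [φ]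
      exact this.trans (AddChar.prod_apply_eq φ _)
    rw [key, mul_pow, iha hao has hφ.comp_inl, ihb hbo hbs hφ.comp_inr]
    push_cast
    rw [map_mul]
    push_cast
    ring

lemma sum_range_coprime_eq_sum_units {M : Type*} [AddCommMonoid M] (n : ℕ) [NeZero n]
    (f : ZMod n → M) :
    ∑ k ∈ (range n).filter (fun k => Nat.gcd k n = 1), f k = ∑ u : (ZMod n)ˣ, f u := by
  symm
  refine sum_bij (fun u _ ↦ (u : ZMod n).val) (fun u _ ↦ ?_) (fun u _ v _ h ↦ ?_)
    (fun k hk ↦ ?_) (fun u _ ↦ by simp)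
  · simpa using ⟨ZMod.val_lt _, ZMod.val_coe_unit_coprime u⟩
  · exact Units.ext (ZMod.val_injective n h)
  · rw [mem_filter, mem_range] at hk
    exact ⟨ZMod.unitOfCoprime k hk.2, mem_univ _, by simp [ZMod.val_cast_of_lt hk.1]⟩

lemma sum_Ico_eq_sum_zmod {M : Type*} [AddCommMonoid M] (n : ℕ) [NeZero n] (f : ZMod n → M) :
    ∑ x ∈ Ico (0 : ℤ) n, f x = ∑ x : ZMod n, f x := by
  symm
  refine sum_bij (fun x _ ↦ (x.val : ℤ)) (fun x _ ↦ ?_) (fun x _ y _ h ↦ ?_)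
    (fun k hk ↦ ?_) (fun x _ ↦ by simp)
  · exact mem_Ico.mpr ⟨by positivity, by exact_mod_cast ZMod.val_lt x⟩
  · exact ZMod.val_injective n (by exact_mod_cast h)
  · rw [mem_Ico] at hk
    exact ⟨k, mem_univ _, by rw [ZMod.val_intCast, Int.emod_eq_of_lt hk.1 hk.2]⟩

lemma en_eq_stdAddChar (n : ℕ) [NeZero n] (x : ℤ) : en n x = ZMod.stdAddChar (x : ZMod n) := by
  rw [ZMod.stdAddChar_coe, en]

lemma ram_eq_sum_units (c : ℤ) (n : ℕ) [NeZero n] :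
    ram c n = ∑ u : (ZMod n)ˣ, ZMod.stdAddChar (u * c : ZMod n) := by
  rw [ram, ← sum_range_coprime_eq_sum_units n fun k ↦ ZMod.stdAddChar (k * c : ZMod n)]
  simp [en_eq_stdAddChar]

lemma gsum_eq_sum_units (n d : ℕ) [NeZero n] (b : Fin d → ℤ) :
    gsum n d b = ∑ u : (ZMod n)ˣ, ∏ i, ∑ x : ZMod n,
      ZMod.stdAddChar ((b i : ZMod n) * x + (u : ZMod n) * x ^ 2) := by
  rw [gsum, ← sum_range_coprime_eq_sum_units n fun k ↦
    ∏ i, ∑ x : ZMod n, ZMod.stdAddChar ((b i : ZMod n) * x + k * x ^ 2)]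
  refine sum_congr rfl fun k _ ↦ ?_
  simp_rw [← sum_Ico_eq_sum_zmod]
  rw [prod_univ_sum]
  refine sum_congr rfl fun x _ ↦ ?_
  rw [en_eq_stdAddChar, mul_sum, ← sum_add_distrib]
  push_cast
  rw [AddChar.map_sum_eq_prod]

/-- Completing the square in a quadratic Gauss sum. -/
lemma sum_addChar_quadratic {R : Type*} [CommRing R] [Fintype R] (ψ : AddChar R ℂ) (b : R)
    {u h : R} {v : R} (huv : u * v = 1) (hh : 2 * h = 1) :
    ∑ x, ψ (b * x + u * x ^ 2) = ψ (-(h ^ 2 * v * b ^ 2)) * ∑ x, ψ.mulShift u (x ^ 2) := by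
  rw [mul_sum, ← (Equiv.subRight (h * v * b)).sum_comp]
  refine sum_congr rfl fun x _ ↦ ?_
  rw [AddChar.mulShift_apply, ← AddChar.map_add_eq_mul]
  congr 1
  simp only [Equiv.subRight_apply]
  linear_combination (h ^ 2 * v * b ^ 2 - 2 * h * b * x) * huv + (-b * x + h * v * b ^ 2) * hh

lemma AddChar.IsPrimitive.apply_intCast_zmod_two {ψ : AddChar (ZMod 2) ℂ} (hψ : ψ.IsPrimitive)
    (C : ℤ) : ψ C = if Even C then 1 else -1 := by
  have h1 : ψ 1 = -1 := by
    have hsum := AddChar.sum_mulShift (1 : ZMod 2) hψ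
    have huniv : (univ : Finset (ZMod 2)) = {0, 1} := rfl
    rw [huniv, sum_pair zero_ne_one] at hsum
    simp at hsum
    linear_combination hsum
  split_ifs with h
  · rw [(ZMod.intCast_eq_zero_iff_even).mpr h, AddChar.map_zero_eq_one]
  · rw [(ZMod.intCast_eq_one_iff_odd).mpr (Int.not_even_iff_odd.mp h), h1]

lemma sum_addChar_zmod_two_prod {R : Type*} [CommRing R] [Fintype R] (ψ : AddChar (ZMod 2 × R) ℂ)
    {b u : ZMod 2 × R} (hb : b.1 = 1) (hu : u.1 = 1) :
    ∑ z, ψ (b * z + u * z ^ 2) =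
      2 * ∑ y, ψ.compAddMonoidHom (AddMonoidHom.inr _ _) (b.2 * y + u.2 * y ^ 2) := by
  have h2 : ∀ x : ZMod 2, x + x ^ 2 = 0 := by decide
  rw [Fintype.sum_prod_type]
  simp only [AddChar.prod_apply_eq ψ, Prod.fst_add, Prod.snd_add, Prod.fst_mul, Prod.snd_mul,
    Prod.pow_fst, Prod.pow_snd, hb, hu, h2, one_mul, AddChar.map_zero_eq_one]
  simp [ZMod.card]

lemma eight_dvd_sum_sq_sub {d : ℕ} (b : Fin d → ℤ) (hb : ∀ i, Odd (b i)) :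
    8 ∣ ∑ i, b i ^ 2 - d := by
  have : ∑ i, b i ^ 2 - d = ∑ i, (b i ^ 2 - 1) := by simp
  rw [this]
  exact dvd_sum fun i _ ↦ Int.eight_dvd_sq_sub_one_of_odd (hb i)

lemma chi_four_pow_eq (m d₁ : ℕ) (hmodd : Odd m) (c C : ℤ) (hC : 2 * C = c + m)
    (hc : 8 ∣ -(2 * c) - (4 * d₁ + 2)) :
    ZMod.χ₄ m ^ (2 * d₁ + 1) = (-1 : ℤ) ^ d₁ * if Even C then 1 else -1 := by
  have hs : ZMod.χ₄ m ^ (2 * d₁ + 1) = ZMod.χ₄ m := by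
    have : m % 4 = 1 ∨ m % 4 = 3 := by have := Nat.odd_iff.mp hmodd; lia
    rcases this with h | h
    · simp [ZMod.χ₄_nat_one_mod_four h]
    · rw [ZMod.χ₄_nat_three_mod_four h, Odd.neg_one_pow ⟨d₁, rfl⟩]
  rw [hs]
  have hm2 := Nat.odd_iff.mp hmodd
  rw [ZMod.χ₄_nat_eq_if_mod_four]
  rcases Nat.even_or_odd d₁ with hd | hd <;> rw [hd.neg_one_pow] <;>
    simp only [Nat.even_iff, Nat.odd_iff, Int.even_iff] at * <;> split_ifs <;> lia

lemma prod_sum_stdAddChar (m d₁ : ℕ) [NeZero m] (hmodd : Odd m) (hsf : Squarefree m)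
    (b : Fin (4 * d₁ + 2) → ℤ) (hb : ∀ i, Odd (b i)) (c C : ℤ)
    (hc : -(∑ i, b i ^ 2) = 2 * c) (hC : 2 * C = c + m) (u : (ZMod (2 * m))ˣ) :
    ∏ i, ∑ x : ZMod (2 * m),
        ZMod.stdAddChar ((b i : ZMod (2 * m)) * x + (u : ZMod (2 * m)) * x ^ 2) =
      (-1 : ℂ) ^ d₁ * (2 * (2 * m) : ℂ) ^ (2 * d₁ + 1) *
        ZMod.stdAddChar ((u⁻¹ : (ZMod (2 * m))ˣ) * C : ZMod (2 * m)) := by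
  let e := ZMod.chineseRemainder (Nat.coprime_two_left.mpr hmodd)
  let φ := (ZMod.stdAddChar (N := 2 * m)).compAddMonoidHom
    (e.symm : ZMod 2 × ZMod m →+ ZMod (2 * m))
  have hφ : φ.IsPrimitive := (ZMod.isPrimitive_stdAddChar _).comp_ringEquiv e.symm
  have hψ (z : ZMod (2 * m)) : ZMod.stdAddChar z = φ (e z) := by simp [φ]
  let φ₂ := φ.compAddMonoidHom (AddMonoidHom.inr _ _)
  have hfst (w : (ZMod (2 * m))ˣ) : (e w).1 = 1 := by
    have h : IsUnit (e w).1 := (w.isUnit.map e).map (RingHom.fst (ZMod 2) (ZMod m))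
    revert h
    generalize (e w).1 = t
    revert t
    decide
  let s : (ZMod m)ˣ := Units.map ((RingHom.snd (ZMod 2) (ZMod m)).comp
    (e : ZMod (2 * m) →+* ZMod 2 × ZMod m)).toMonoidHom u
  have hs : (s : ZMod m) = (e u).2 := rfl
  have hs' : ((s⁻¹ : (ZMod m)ˣ) : ZMod m) = (e (u⁻¹ : (ZMod (2 * m))ˣ)).2 := rfl
  obtain ⟨h, hh⟩ : ∃ h : ZMod m, 2 * h = 1 :=
    ((ZMod.isUnit_iff_coprime 2 m).mpr (Nat.coprime_two_left.mpr hmodd)).exists_right_inv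
  set T := ∑ y, φ₂.mulShift s (y ^ 2)
  have hT2 : T ^ 2 = (ZMod.χ₄ m : ℂ) * m :=
    sum_addChar_sq_sq m hmodd hsf (hφ.comp_inr.mulShift_unit s)
  have hfac (i) : ∑ x : ZMod (2 * m),
      ZMod.stdAddChar ((b i : ZMod (2 * m)) * x + (u : ZMod (2 * m)) * x ^ 2) =
      2 * (φ₂ (-(h ^ 2 * (s⁻¹ : (ZMod m)ˣ) * (b i : ZMod m) ^ 2)) * T) := by
    have hbi : (e (b i : ZMod (2 * m))).1 = 1 := by
      rw [map_intCast]
      simpa using (ZMod.intCast_eq_one_iff_odd).mpr (hb i)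
    rw [← sum_addChar_quadratic φ₂ _ (Units.mul_inv s) hh, ← e.symm.toEquiv.sum_comp]
    have := sum_addChar_zmod_two_prod φ hbi (hfst u)
    simpa [hψ, φ₂, hs] using this
  have hC2 : (C : ZMod m) = h * c := by
    have : (2 * C : ZMod m) = c := by
      have := congrArg (Int.cast : ℤ → ZMod m) hC
      simpa using this
    linear_combination h * this - C * hh
  have hrhs : ZMod.stdAddChar ((u⁻¹ : (ZMod (2 * m))ˣ) * C : ZMod (2 * m)) =
      (if Even C then 1 else -1) * φ₂ ((s⁻¹ : (ZMod m)ˣ) * (h * c)) := by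
    rw [hψ, AddChar.prod_apply_eq φ, ← hC2, ← hφ.comp_inl.apply_intCast_zmod_two C]
    simp only [map_mul, map_intCast, Prod.fst_mul, Prod.snd_mul, hfst, one_mul, hs',
      Prod.fst_intCast, Prod.snd_intCast, φ₂]
  have hphase : ∏ i, φ₂ (-(h ^ 2 * (s⁻¹ : (ZMod m)ˣ) * (b i : ZMod m) ^ 2)) =
      φ₂ ((s⁻¹ : (ZMod m)ˣ) * (h * c)) := by
    rw [← AddChar.map_sum_eq_prod, sum_neg_distrib, ← mul_sum]
    congr 1
    have hsum := congrArg (Int.cast : ℤ → ZMod m) hc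
    push_cast at hsum
    linear_combination h ^ 2 * (s⁻¹ : (ZMod m)ˣ) * hsum + h * (s⁻¹ : (ZMod m)ˣ) * c * hh
  have hsign := chi_four_pow_eq m d₁ hmodd c C hC (by
    have := eight_dvd_sum_sq_sub b hb
    push_cast at this
    rwa [← hc, neg_neg])
  have hsign' : (ZMod.χ₄ m : ℂ) ^ (2 * d₁ + 1) = (-1 : ℂ) ^ d₁ * if Even C then 1 else -1 := by
    exact_mod_cast congrArg (Int.cast : ℤ → ℂ) hsign
  simp_rw [hfac]
  rw [prod_mul_distrib, prod_mul_distrib, hphase, hrhs]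
  simp only [prod_const, card_univ, Fintype.card_fin]
  have h4 : 4 * d₁ + 2 = 2 * (2 * d₁ + 1) := by ring
  rw [h4, pow_mul, pow_mul T, hT2, mul_pow (ZMod.χ₄ m : ℂ), hsign']
  have h2m : (2 * (2 * m) : ℂ) ^ (2 * d₁ + 1) = (2 ^ 2) ^ (2 * d₁ + 1) * m ^ (2 * d₁ + 1) := by
    rw [← mul_pow]
    congr 1
    ring
  rw [h2m]
  ac_rfl

/-- For `n = 2m` squarefree even (`m` odd), `d = 4d₁ + 2` and all `b_i` odd, writing
`−b·b = 2c` with `c` odd, `g_n(b) = (−1)^{d₁} (2n)^{2d₁+1} r((c+m)/2, n)`. -/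
theorem gsum_eq_case_d_four_plus_two (m d₁ : ℕ) (hm : 0 < m) (hmodd : Odd m)
    (hsf : Squarefree (2 * m)) (b : Fin (4 * d₁ + 2) → ℤ) (hb : ∀ i, Odd (b i))
    (c : ℤ) (hc : -(∑ i, b i ^ 2) = 2 * c) (hcodd : Odd c) :
    gsum (2 * m) (4 * d₁ + 2) b =
      (-1 : ℂ) ^ d₁ * (2 * (2 * m) : ℂ) ^ (2 * d₁ + 1) * ram ((c + m) / 2) (2 * m) := by
  have : NeZero m := ⟨hm.ne'⟩
  have hC : 2 * ((c + m) / 2) = c + m :=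
    Int.mul_ediv_cancel' (hcodd.add_odd (by exact_mod_cast hmodd)).two_dvd
  rw [gsum_eq_sum_units, ram_eq_sum_units, mul_sum,
    ← Equiv.sum_comp (Equiv.inv (ZMod (2 * m))ˣ) fun u ↦
      _ * ZMod.stdAddChar ((u : ZMod (2 * m)) * _)]
  refine sum_congr rfl fun u _ ↦ ?_
  exact prod_sum_stdAddChar m d₁ hmodd (hsf.squarefree_of_dvd (Dvd.intro_left 2 rfl)) b hb c _ hc
    hC u
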